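/- arXiv:2605.01830 — 7 statements merged into one kernel-verified Lean document; each statement's English description precedes it below -/
import Mathlib

section
/- Let a > 0 and 0 < b < π. Then the auxiliary integral I(a,b) = ∫₀^b arctan((a + cos β)/sin β) dβ satisfies the closed form I(a,b) = πb/2 − b²/2 − Li₂(−a) + Re(Li₂(−a·e^{ib})). -/
open scoped Real

/-- The principal-branch dilogarithm, `Li₂(z) = −∫₀¹ Log(1 − z t)/t dt`. -/
noncomputable def Li2 (z : ℂ) : ℂ :=
  -∫ t in (0:ℝ)..1, Complex.log (1 - z * (t : ℂ)) / (t : ℂ)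

/-- The auxiliary integral `I(a,b) = ∫₀^b arctan((a + cos β)/sin β) dβ`. -/
noncomputable def I (a b : ℝ) : ℝ :=
  ∫ β in (0:ℝ)..b, Real.arctan ((a + Real.cos β) / Real.sin β)

open Set MeasureTheory

theorem intervalIntegrable_log_one_sub_mul_div {z : ℂ}
    (hz : ∀ t ∈ Icc (0:ℝ) 1, 1 - z * (t : ℂ) ∈ Complex.slitPlane) :
    IntervalIntegrable (fun t : ℝ => Complex.log (1 - z * (t : ℂ)) / (t : ℂ)) volume 0 1 := by
  have hU : IsOpen {u : ℂ | 1 - z * u ∈ Complex.slitPlane} :=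
    Complex.isOpen_slitPlane.preimage (by fun_prop)
  have hd : ∀ u ∈ {u : ℂ | 1 - z * u ∈ Complex.slitPlane},
      DifferentiableAt ℂ (fun u => Complex.log (1 - z * u)) u := fun u hu =>
    DifferentiableAt.clog (by fun_prop) hu
  have h0 : (0 : ℂ) ∈ {u : ℂ | 1 - z * u ∈ Complex.slitPlane} := by simp
  have hc : ContinuousOn (fun t : ℝ => dslope (fun u : ℂ => Complex.log (1 - z * u)) 0 (t : ℂ))
      (Icc 0 1) :=
    ((continuousOn_dslope (hU.mem_nhds h0)).2
      ⟨fun u hu => (hd u hu).continuousAt.continuousWithinAt, hd 0 h0⟩).comp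
      Complex.continuous_ofReal.continuousOn fun t ht => hz t ht
  refine (hc.intervalIntegrable_of_Icc zero_le_one).congr fun t ht => ?_
  rw [uIoc_of_le zero_le_one] at ht
  have ht0 : (t : ℂ) ≠ 0 := by exact_mod_cast ht.1.ne'
  simp [dslope_of_ne _ ht0, slope_def_field]

theorem Li2_mul_exp_sub_Li2 {c : ℂ} {b : ℝ}
    (hc : ∀ β ∈ uIcc 0 b, ∀ t ∈ Icc (0:ℝ) 1,
      1 - c * Complex.exp (Complex.I * (β : ℂ)) * (t : ℂ) ∈ Complex.slitPlane) :
    Li2 (c * Complex.exp (Complex.I * (b : ℂ))) - Li2 c =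
      -(Complex.I * ∫ β in (0:ℝ)..b,
        Complex.log (1 - c * Complex.exp (Complex.I * (β : ℂ)))) := by
  set K : ℝ → ℝ → ℂ := fun β t =>
    -(Complex.I * (c * Complex.exp (Complex.I * (β : ℂ)))) /
    (1 - c * Complex.exp (Complex.I * (β : ℂ)) * (t : ℂ))
  have hKc : ContinuousOn K.uncurry (uIcc 0 b ×ˢ Icc 0 1) := by
    refine ContinuousOn.div (Continuous.continuousOn (by fun_prop))
      (Continuous.continuousOn (by fun_prop)) ?_
    rintro ⟨β, t⟩ ⟨hβ, ht⟩
    exact Complex.slitPlane_ne_zero (hc β hβ t ht)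
  have hswap : ∫ β in (0:ℝ)..b, ∫ t in (0:ℝ)..1, K β t =
      ∫ t in (0:ℝ)..1, ∫ β in (0:ℝ)..b, K β t := by
    refine intervalIntegral_intervalIntegral_swap
      ((hKc.integrableOn_compact (isCompact_uIcc.prod isCompact_Icc)).mono_set
        (prod_mono uIoc_subset_uIcc ?_))
    rw [uIoc_of_le zero_le_one]
    exact Ioc_subset_Icc_self
  have hinner_t : ∀ β ∈ uIcc 0 b, ∫ t in (0:ℝ)..1, K β t =
      Complex.I * Complex.log (1 - c * Complex.exp (Complex.I * (β : ℂ))) := by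
    intro β hβ
    rw [intervalIntegral.integral_eq_sub_of_hasDerivAt (f := fun t : ℝ => Complex.I *
      Complex.log (1 - c * Complex.exp (Complex.I * (β : ℂ)) * (t : ℂ)))]
    · simp
    · intro t ht
      rw [uIcc_of_le zero_le_one] at ht
      have h1 : HasDerivAt (fun t : ℝ => 1 - c * Complex.exp (Complex.I * (β : ℂ)) * (t : ℂ))
          (-(c * Complex.exp (Complex.I * (β : ℂ)))) t := by
        simpa using ((Complex.ofRealCLM.hasDerivAt (x := t)).const_mul
          (c * Complex.exp (Complex.I * (β : ℂ)))).const_sub 1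
      refine ((h1.clog_real (hc β hβ t ht)).const_mul Complex.I).congr_deriv ?_
      ring
    · refine ContinuousOn.intervalIntegrable_of_Icc zero_le_one ?_
      exact hKc.comp (f := fun t : ℝ => (β, t)) (by fun_prop) fun t ht => ⟨hβ, ht⟩
  have hinner_β : ∀ t ∈ Ioo (0:ℝ) 1, ∫ β in (0:ℝ)..b, K β t =
      Complex.log (1 - c * Complex.exp (Complex.I * (b : ℂ)) * (t : ℂ)) / (t : ℂ) -
      Complex.log (1 - c * (t : ℂ)) / (t : ℂ) := by
    intro t ht
    have ht0 : (t : ℂ) ≠ 0 := by exact_mod_cast ht.1.ne'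
    rw [intervalIntegral.integral_eq_sub_of_hasDerivAt (f := fun β : ℝ =>
      Complex.log (1 - c * Complex.exp (Complex.I * (β : ℂ)) * (t : ℂ)) / (t : ℂ))]
    · simp
    · intro β hβ
      have h1 : HasDerivAt (fun β : ℝ => 1 - c * Complex.exp (Complex.I * (β : ℂ)) * (t : ℂ))
          (-(c * (Complex.exp (Complex.I * (β : ℂ)) * Complex.I) * (t : ℂ))) β := by
        simpa using (((((Complex.ofRealCLM.hasDerivAt (x := β)).const_mul
          Complex.I).cexp).const_mul c).mul_const (t : ℂ)).const_sub 1
      refine ((h1.clog_real (hc β hβ t (Ioo_subset_Icc_self ht))).div_const (t : ℂ)).congr_deriv ?_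
      simp only [K]
      field_simp
    · refine ContinuousOn.intervalIntegrable ?_
      exact hKc.comp (f := fun β : ℝ => (β, t)) (by fun_prop)
        fun β hβ => ⟨hβ, Ioo_subset_Icc_self ht⟩
  rw [intervalIntegral.integral_congr hinner_t, intervalIntegral.integral_const_mul,
    intervalIntegral.integral_congr_Ioo_of_le zero_le_one hinner_β,
    intervalIntegral.integral_sub] at hswap
  · rw [hswap, Li2, Li2]
    ring
  · exact intervalIntegrable_log_one_sub_mul_div (hc b right_mem_uIcc)
  · exact intervalIntegrable_log_one_sub_mul_div (by simpa using hc 0 left_mem_uIcc)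

theorem one_add_mul_exp_mem_slitPlane {a β : ℝ} (ha : 0 ≤ a) (hβ0 : 0 ≤ β) (hβπ : β < π) :
    1 + (a : ℂ) * Complex.exp (Complex.I * (β : ℂ)) ∈ Complex.slitPlane := by
  rw [Complex.mem_slitPlane_iff, mul_comm Complex.I, Complex.exp_mul_I, ← Complex.ofReal_cos,
    ← Complex.ofReal_sin]
  simp only [Complex.add_re, Complex.one_re, Complex.re_ofReal_mul, Complex.ofReal_re,
    Complex.mul_I_re, Complex.ofReal_im, Complex.add_im, Complex.one_im, Complex.im_ofReal_mul,
    Complex.mul_I_im]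
  rcases hβ0.eq_or_lt with rfl | hβ
  · left
    simp
    positivity
  rcases ha.eq_or_lt with rfl | ha
  · left
    simp
  · right
    have := mul_pos ha (Real.sin_pos_of_pos_of_lt_pi hβ hβπ)
    simpa using this.ne'

theorem arctan_add_cos_div_sin (a : ℝ) {β : ℝ} (hβ0 : 0 < β) (hβπ : β < π) :
    Real.arctan ((a + Real.cos β) / Real.sin β) =
      π / 2 - β + (Complex.log (1 + (a : ℂ) * Complex.exp (Complex.I * (β : ℂ)))).im := by
  have hs := Real.sin_pos_of_pos_of_lt_pi hβ0 hβπ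
  set ψ := Real.arctan ((a + Real.cos β) / Real.sin β) with hψ
  have h1 : -(π / 2) < ψ := Real.neg_pi_div_two_lt_arctan _
  have h2 : ψ < π / 2 := Real.arctan_lt_pi_div_two _
  have hcos : 0 < Real.cos ψ := Real.cos_pos_of_mem_Ioo ⟨h1, h2⟩
  have htan : Real.sin ψ * Real.sin β = (a + Real.cos β) * Real.cos ψ := by
    have := Real.tan_arctan ((a + Real.cos β) / Real.sin β)
    rw [← hψ, Real.tan_eq_sin_div_cos] at this
    field_simp at this
    linarith
  have hpolar : 1 + (a : ℂ) * Complex.exp (Complex.I * (β : ℂ)) =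
      ((Real.sin β / Real.cos ψ : ℝ) : ℂ) *
        (Complex.cos ((β + ψ - π / 2 : ℝ) : ℂ) +
          Complex.sin ((β + ψ - π / 2 : ℝ) : ℂ) * Complex.I) := by
    rw [mul_comm Complex.I, Complex.exp_mul_I, ← Complex.ofReal_cos,
      ← Complex.ofReal_sin, ← Complex.ofReal_cos, ← Complex.ofReal_sin,
      Real.cos_sub_pi_div_two, Real.sin_sub_pi_div_two, Real.sin_add, Real.cos_add]
    have hsq := Real.sin_sq_add_cos_sq β
    apply Complex.ext <;>
      simp only [Complex.add_re, Complex.one_re, Complex.re_ofReal_mul, Complex.ofReal_re,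
        Complex.mul_I_re, Complex.ofReal_im, Complex.add_im, Complex.one_im,
        Complex.im_ofReal_mul, Complex.mul_I_im] <;> field_simp
    · linear_combination (-Real.cos ψ) * hsq - Real.cos β * htan
    · linear_combination (-Real.sin β) * htan
  rw [Complex.log_im, hpolar, Complex.arg_mul_cos_add_sin_mul_I (div_pos hs hcos)
    ⟨by linarith, by linarith⟩]
  ring

theorem stmt_0 (a b : ℝ) (ha : 0 < a) (hb0 : 0 < b) (hbπ : b < π) :
    I a b = π * b / 2 - b ^ 2 / 2 - (Li2 (-(a : ℂ))).re
      + (Li2 (-(a : ℂ) * Complex.exp (Complex.I * (b : ℂ)))).re := by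
  have hmem : ∀ β ∈ uIcc 0 b, ∀ t ∈ Icc (0:ℝ) 1,
      1 - -(a : ℂ) * Complex.exp (Complex.I * (β : ℂ)) * (t : ℂ) ∈ Complex.slitPlane := by
    intro β hβ t ht
    rw [uIcc_of_le hb0.le] at hβ
    convert one_add_mul_exp_mem_slitPlane (mul_nonneg ha.le ht.1) hβ.1
      (hβ.2.trans_lt hbπ) using 1
    push_cast
    ring
  have hint : IntervalIntegrable
      (fun β : ℝ => Complex.log (1 + (a : ℂ) * Complex.exp (Complex.I * (β : ℂ))))
      volume 0 b := by
    refine ContinuousOn.intervalIntegrable (ContinuousOn.clog (by fun_prop) fun β hβ => ?_)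
    rw [uIcc_of_le hb0.le] at hβ
    exact one_add_mul_exp_mem_slitPlane ha.le hβ.1 (hβ.2.trans_lt hbπ)
  have hint_im : IntervalIntegrable
      (fun β : ℝ => (Complex.log (1 + (a : ℂ) * Complex.exp (Complex.I * (β : ℂ)))).im)
      volume 0 b := ⟨hint.1.im, hint.2.im⟩
  have hLi := congrArg Complex.re (Li2_mul_exp_sub_Li2 hmem)
  simp only [neg_mul, sub_neg_eq_add, Complex.sub_re, Complex.neg_re, Complex.I_mul_re,
    neg_neg] at hLi
  have him : ∫ β in (0:ℝ)..b,
      (Complex.log (1 + (a : ℂ) * Complex.exp (Complex.I * (β : ℂ)))).im =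
      (∫ β in (0:ℝ)..b, Complex.log (1 + (a : ℂ) * Complex.exp (Complex.I * (β : ℂ)))).im :=
    Complex.imCLM.intervalIntegral_comp_comm hint
  rw [I, intervalIntegral.integral_congr_Ioo_of_le hb0.le
    fun β hβ => arctan_add_cos_div_sin a hβ.1 (hβ.2.trans hbπ),
    intervalIntegral.integral_add (Continuous.intervalIntegrable (by fun_prop) _ _) hint_im, him, ← hLi, intervalIntegral.integral_sub (by simp) (by simp)]
  simp
  ring
end

section
/- For every fixed b with 0 < b < π, the function a ↦ I(a,b) is differentiable on (0,∞) and its partial derivative with respect to a equals (1/(2a))·log((1+a)²/(1 + 2a·cos b + a²)). -/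
open scoped Real

/-- On `[0, b]` with `b < π`, the quantity `1 + 2 a cos β + a²` is at least `sin² b`. -/
lemma sin_sq_le_one_add_two_mul_cos_add_sq {a b β : ℝ} (ha : 0 < a) (hβ : 0 ≤ β) (hβb : β ≤ b)
    (hb : b ≤ π) : Real.sin b ^ 2 ≤ 1 + 2 * a * Real.cos β + a ^ 2 := by
  have hcos : Real.cos b ≤ Real.cos β := Real.cos_le_cos_of_nonneg_of_le_pi hβ hb hβb
  nlinarith [Real.sin_sq_add_cos_sq b, sq_nonneg (a + Real.cos b),
    mul_le_mul_of_nonneg_left hcos ha.le]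

lemma hasDerivAt_arctan_add_cos_div_sin {β : ℝ} (hβ : Real.sin β ≠ 0) (a : ℝ) :
    HasDerivAt (fun x => Real.arctan ((x + Real.cos β) / Real.sin β))
      (Real.sin β / (1 + 2 * a * Real.cos β + a ^ 2)) a := by
  have h := (((hasDerivAt_id a).add_const (Real.cos β)).div_const (Real.sin β)).arctan
  simp only [id] at h
  have hD : 1 + 2 * a * Real.cos β + a ^ 2 = Real.sin β ^ 2 + (a + Real.cos β) ^ 2 := by
    linear_combination -Real.sin_sq_add_cos_sq β
  have hpos : 0 < Real.sin β ^ 2 + (a + Real.cos β) ^ 2 := by positivity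
  convert h using 1
  rw [hD]
  field_simp

lemma integral_sin_div_one_add_two_mul_cos_add_sq {a b : ℝ} (ha : 0 < a) (hb0 : 0 < b)
    (hbπ : b < π) (hint : IntervalIntegrable
      (fun β => Real.sin β / (1 + 2 * a * Real.cos β + a ^ 2)) MeasureTheory.volume 0 b) :
    ∫ β in (0:ℝ)..b, Real.sin β / (1 + 2 * a * Real.cos β + a ^ 2) =
      1 / (2 * a) * Real.log ((1 + a) ^ 2 / (1 + 2 * a * Real.cos b + a ^ 2)) := by
  have hsin : 0 < Real.sin b ^ 2 := pow_pos (Real.sin_pos_of_pos_of_lt_pi hb0 hbπ) 2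
  have hD : ∀ β ∈ Set.uIcc 0 b, 0 < 1 + 2 * a * Real.cos β + a ^ 2 := fun β hβ => by
    rw [Set.uIcc_of_le hb0.le] at hβ
    exact hsin.trans_le (sin_sq_le_one_add_two_mul_cos_add_sq ha hβ.1 hβ.2 hbπ.le)
  rw [intervalIntegral.integral_eq_sub_of_hasDerivAt
    (f := fun β => -(1 / (2 * a)) * Real.log (1 + 2 * a * Real.cos β + a ^ 2)) _ hint,
    Real.log_div (by positivity) (hD b Set.right_mem_uIcc).ne', Real.cos_zero,
    show 1 + 2 * a * 1 + a ^ 2 = (1 + a) ^ 2 by ring]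
  · ring
  · intro β hβ
    have hDβ := hD β hβ
    refine ((((((Real.hasDerivAt_cos β).const_mul (2 * a)).const_add 1).add_const (a ^ 2)).log
      hDβ.ne').const_mul (-(1 / (2 * a)))).congr_deriv ?_
    field_simp

theorem stmt_1 (b : ℝ) (hb0 : 0 < b) (hbπ : b < π) :
    ∀ a ∈ Set.Ioi (0:ℝ), HasDerivAt (fun a => I a b)
      (1 / (2 * a) * Real.log ((1 + a) ^ 2 / (1 + 2 * a * Real.cos b + a ^ 2))) a := by
  intro a ha
  have hsinb : 0 < Real.sin b ^ 2 := pow_pos (Real.sin_pos_of_pos_of_lt_pi hb0 hbπ) 2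
  have hmeas (x : ℝ) : Measurable fun β => Real.arctan ((x + Real.cos β) / Real.sin β) :=
    Real.measurable_arctan.comp
      ((measurable_const.add Real.measurable_cos).div Real.measurable_sin)
  have hint : IntervalIntegrable (fun β => Real.arctan ((a + Real.cos β) / Real.sin β))
      MeasureTheory.volume 0 b := by
    refine (intervalIntegrable_const (c := π / 2)).mono_fun (hmeas a).aestronglyMeasurable
      (Filter.Eventually.of_forall fun β => ?_)
    rw [Real.norm_of_nonneg (by positivity : (0:ℝ) ≤ π / 2)]
    exact abs_le.2 ⟨(Real.neg_pi_div_two_lt_arctan _).le, (Real.arctan_lt_pi_div_two _).le⟩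
  have key := intervalIntegral.hasDerivAt_integral_of_dominated_loc_of_deriv_le
    (μ := MeasureTheory.volume) (a := 0) (b := b) (x₀ := a) (s := Set.Ioi 0)
    (F := fun x β => Real.arctan ((x + Real.cos β) / Real.sin β))
    (F' := fun x β => Real.sin β / (1 + 2 * x * Real.cos β + x ^ 2))
    (bound := fun _ => 1 / Real.sin b ^ 2)
    (Ioi_mem_nhds ha)
    (Filter.Eventually.of_forall fun x => (hmeas x).aestronglyMeasurable) hint
    (Measurable.aestronglyMeasurable (by fun_prop))
    (Filter.Eventually.of_forall fun β hβ x hx => by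
      rw [Set.uIoc_of_le hb0.le] at hβ
      have h := sin_sq_le_one_add_two_mul_cos_add_sq hx hβ.1.le hβ.2 hbπ.le
      rw [norm_div, Real.norm_of_nonneg (hsinb.le.trans h)]
      exact div_le_div₀ zero_le_one (Real.abs_sin_le_one β) hsinb h)
    intervalIntegrable_const
    (Filter.Eventually.of_forall fun β hβ x _ => by
      rw [Set.uIoc_of_le hb0.le] at hβ
      exact hasDerivAt_arctan_add_cos_div_sin
        (Real.sin_pos_of_pos_of_lt_pi hβ.1 (hβ.2.trans_lt hbπ)).ne' x)
  rw [← integral_sin_div_one_add_two_mul_cos_add_sq ha hb0 hbπ key.1]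
  exact key.2
end

section
/- For every a > 0, the inverse tangent integral satisfies Ti₂(a) = arctan(a)·log(a) + Im(Li₂(1 + i·a)) − (π/4)·log(1 + a²). -/
open scoped Real

/-- The inverse tangent integral `Ti₂(y) = ∫₀^y arctan(x)/x dx`. -/
noncomputable def Ti2 (y : ℝ) : ℝ :=
  ∫ x in (0:ℝ)..y, Real.arctan x / x

open MeasureTheory Set Filter Topology

theorem Complex.arg_eq_arctan_of_re_pos {z : ℂ} (hz : 0 < z.re) :
    z.arg = Real.arctan (z.im / z.re) := by
  have h := abs_lt.1 (Complex.abs_arg_lt_pi_div_two_iff.2 (Or.inl hz))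
  rw [← Complex.tan_arg, Real.arctan_tan h.1 h.2]

theorem Real.arctan_le_self {x : ℝ} (hx : 0 ≤ x) : Real.arctan x ≤ x := by
  have h := Real.le_tan (Real.arctan_nonneg.2 hx) (Real.arctan_lt_pi_div_two x)
  rwa [Real.tan_arctan] at h

theorem continuous_dslope_arctan : Continuous (dslope Real.arctan 0) := by
  rw [← continuousOn_univ, continuousOn_dslope univ_mem]
  exact ⟨Real.continuous_arctan.continuousOn, Real.differentiable_arctan 0⟩

theorem dslope_arctan_of_ne {x : ℝ} (hx : x ≠ 0) :
    dslope Real.arctan 0 x = Real.arctan x / x := by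
  rw [dslope_of_ne _ hx, slope_def_field, Real.arctan_zero, sub_zero, sub_zero]

theorem Ti2_eq_integral_dslope (y : ℝ) : Ti2 y = ∫ x in (0:ℝ)..y, dslope Real.arctan 0 x := by
  refine intervalIntegral.integral_congr_ae ?_
  filter_upwards [compl_mem_ae_iff.2 (measure_singleton (0:ℝ))] with x hx _
  exact (dslope_arctan_of_ne hx).symm

theorem Ti2_zero : Ti2 0 = 0 := intervalIntegral.integral_same

theorem hasDerivAt_Ti2 (y : ℝ) : HasDerivAt Ti2 (dslope Real.arctan 0 y) y := by
  rw [funext Ti2_eq_integral_dslope]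
  exact (continuous_dslope_arctan.integral_hasStrictDerivAt 0 y).hasDerivAt

theorem one_sub_mul_mem_slitPlane {a : ℝ} (ha : a ≠ 0) (t : ℝ) :
    1 - (1 + Complex.I * (a : ℂ)) * (t : ℂ) ∈ Complex.slitPlane := by
  rw [Complex.mem_slitPlane_iff]
  rcases eq_or_ne t 0 with rfl | ht
  · simp
  · right
    simp [ha, ht]

theorem intervalIntegrable_log_div {a : ℝ} (ha : a ≠ 0) :
    IntervalIntegrable
      (fun t : ℝ => Complex.log (1 - (1 + Complex.I * (a : ℂ)) * (t : ℂ)) / (t : ℂ))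
      volume 0 1 := by
  set f : ℝ → ℂ := fun t => Complex.log (1 - (1 + Complex.I * (a : ℂ)) * (t : ℂ)) with hf
  have hd : Differentiable ℝ f := fun t => by
    have h1 : DifferentiableAt ℝ (fun t : ℝ => 1 - (1 + Complex.I * (a : ℂ)) * (t : ℂ)) t :=
      ((Complex.ofRealCLM.differentiableAt).const_mul _).const_sub _
    exact (h1.hasDerivAt.clog_real (one_sub_mul_mem_slitPlane ha t)).differentiableAt
  have hc : Continuous (dslope f 0) := by
    rw [← continuousOn_univ, continuousOn_dslope univ_mem]
    exact ⟨hd.continuous.continuousOn, hd 0⟩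
  refine (hc.intervalIntegrable 0 1).congr_uIoo fun t ht => ?_
  rw [uIoo_of_le zero_le_one] at ht
  rw [dslope_of_ne _ ht.1.ne', slope_def_module]
  simp [hf, div_eq_inv_mul]

theorem Li2_im_eq_integral {a : ℝ} (ha : a ≠ 0) :
    (Li2 (1 + Complex.I * (a : ℂ))).im =
      ∫ t in (0:ℝ)..1, Real.arctan (a * t / (1 - t)) / t := by
  have h := Complex.imCLM.intervalIntegral_comp_comm (intervalIntegrable_log_div ha)
  simp only [Complex.imCLM_apply] at h
  rw [Li2, Complex.neg_im, ← h, ← intervalIntegral.integral_neg]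
  refine intervalIntegral.integral_congr_uIoo fun t ht => ?_
  rw [uIoo_of_le zero_le_one] at ht
  have hre : (1 - (1 + Complex.I * (a : ℂ)) * (t : ℂ)).re = 1 - t := by simp
  have him : (1 - (1 + Complex.I * (a : ℂ)) * (t : ℂ)).im = -(a * t) := by simp
  have hpos : 0 < (1 - (1 + Complex.I * (a : ℂ)) * (t : ℂ)).re := by
    rw [hre]; linarith [ht.2]
  simp only [Complex.div_ofReal_im, Complex.log_im]
  rw [Complex.arg_eq_arctan_of_re_pos hpos, hre, him, neg_div, Real.arctan_neg, neg_div, neg_neg]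

theorem norm_arctan_div_le {b t : ℝ} (hb : 0 ≤ b) (ht : t ∈ Ioc (0:ℝ) 1) :
    ‖Real.arctan (b * t / (1 - t)) / t‖ ≤ 2 * b + π := by
  have h0 : 0 ≤ b * t / (1 - t) :=
    div_nonneg (mul_nonneg hb ht.1.le) (by linarith [ht.2])
  rw [Real.norm_of_nonneg (div_nonneg (Real.arctan_nonneg.2 h0) ht.1.le), div_le_iff₀ ht.1]
  rcases le_total t (1 / 2) with h | h
  · refine (Real.arctan_le_self h0).trans ?_
    rw [div_le_iff₀ (by linarith)]
    have h1 : 0 ≤ b * t * (1 - 2 * t) := mul_nonneg (mul_nonneg hb ht.1.le) (by linarith)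
    have h2 : 0 ≤ π * t * (1 - t) :=
      mul_nonneg (mul_nonneg Real.pi_pos.le ht.1.le) (by linarith)
    linarith
  · have := Real.arctan_lt_pi_div_two (b * t / (1 - t))
    have := mul_nonneg hb ht.1.le
    nlinarith [Real.pi_pos]

theorem aestronglyMeasurable_arctan_div (b : ℝ) (μ : Measure ℝ) :
    AEStronglyMeasurable (fun t : ℝ => Real.arctan (b * t / (1 - t)) / t) μ := by
  have : Measurable (fun t : ℝ => Real.arctan (b * t / (1 - t)) / t) :=
    (Real.measurable_arctan.comp (by fun_prop)).div measurable_id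
  exact this.aestronglyMeasurable

theorem continuousOn_integral_arctan_div :
    ContinuousOn (fun b : ℝ => ∫ t in (0:ℝ)..1, Real.arctan (b * t / (1 - t)) / t) (Ici 0) := by
  intro b _
  refine intervalIntegral.continuousWithinAt_of_dominated_interval
    (bound := fun _ => 2 * (b + 1) + π)
    (Eventually.of_forall fun _ => aestronglyMeasurable_arctan_div _ _) ?_
    intervalIntegrable_const (Eventually.of_forall fun t _ => ?_)
  · have h1 : ∀ᶠ x in 𝓝[Ici 0] b, x < b + 1 :=
      nhdsWithin_le_nhds (Iio_mem_nhds (by linarith))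
    filter_upwards [h1, self_mem_nhdsWithin] with x hx hx0
    refine Eventually.of_forall fun t ht => ?_
    rw [uIoc_of_le zero_le_one] at ht
    exact (norm_arctan_div_le hx0 ht).trans (by linarith)
  · have : Continuous fun x : ℝ => Real.arctan (x * t / (1 - t)) / t :=
      (Real.continuous_arctan.comp (by fun_prop)).div_const t
    exact this.continuousWithinAt

theorem div_one_add_sq_le (b t : ℝ) :
    b ^ 2 / (1 + b ^ 2) ≤ (1 - t) ^ 2 + b ^ 2 * t ^ 2 := by
  rw [div_le_iff₀ (by positivity)]
  nlinarith [sq_nonneg ((1 + b ^ 2) * t - 1)]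

theorem one_sub_sq_add_pos {b : ℝ} (hb : 0 < b) (t : ℝ) :
    0 < (1 - t) ^ 2 + b ^ 2 * t ^ 2 :=
  lt_of_lt_of_le (by positivity) (div_one_add_sq_le b t)

theorem continuous_one_sub_div {b : ℝ} (hb : 0 < b) :
    Continuous fun t : ℝ => (1 - t) / ((1 - t) ^ 2 + b ^ 2 * t ^ 2) :=
  (by fun_prop : Continuous fun t : ℝ => 1 - t).div (by fun_prop)
    fun t => (one_sub_sq_add_pos hb t).ne'

theorem integral_one_sub_div {b : ℝ} (hb : 0 < b) :
    ∫ t in (0:ℝ)..1, (1 - t) / ((1 - t) ^ 2 + b ^ 2 * t ^ 2) =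
      (π / 2 * b - Real.log b) / (1 + b ^ 2) := by
  have hder : ∀ t ∈ uIcc (0:ℝ) 1, HasDerivAt
      (fun t : ℝ => (b * Real.arctan (((1 + b ^ 2) * t - 1) / b)
        - Real.log ((1 - t) ^ 2 + b ^ 2 * t ^ 2) / 2) / (1 + b ^ 2))
      ((1 - t) / ((1 - t) ^ 2 + b ^ 2 * t ^ 2)) t := by
    intro t _
    have hD := one_sub_sq_add_pos hb t
    have h1 : HasDerivAt (fun t : ℝ => ((1 + b ^ 2) * t - 1) / b) ((1 + b ^ 2) * 1 / b) t :=
      (((hasDerivAt_id t).const_mul _).sub_const _).div_const _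
    have h2 : HasDerivAt (fun t : ℝ => (1 - t) ^ 2 + b ^ 2 * t ^ 2)
        (2 * (1 - t) * (-1) + b ^ 2 * (2 * t)) t := by
      have h3 := (((hasDerivAt_id t).const_sub 1).pow 2).add
        (((hasDerivAt_id t).pow 2).const_mul (b ^ 2))
      refine h3.congr_deriv ?_
      simp
    refine (((h1.arctan.const_mul b).sub ((h2.log hD.ne').div_const 2)).div_const
      (1 + b ^ 2)).congr_deriv ?_
    have h4 : 1 + (((1 + b ^ 2) * t - 1) / b) ^ 2 =
        (1 + b ^ 2) * ((1 - t) ^ 2 + b ^ 2 * t ^ 2) / b ^ 2 := by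
      field_simp
      ring
    rw [h4]
    have h5 : 1 + b ^ 2 ≠ 0 := by positivity
    have h6 := hD.ne'
    field_simp
    ring
  rw [intervalIntegral.integral_eq_sub_of_hasDerivAt hder
    ((continuous_one_sub_div hb).intervalIntegrable _ _)]
  have e1 : ((1 + b ^ 2) * 1 - 1) / b = b := by field_simp; ring
  have e0 : ((1 + b ^ 2) * 0 - 1) / b = -b⁻¹ := by field_simp; ring
  have e2 : (1 - (1:ℝ)) ^ 2 + b ^ 2 * 1 ^ 2 = b ^ 2 := by ring
  have e3 : (1 - (0:ℝ)) ^ 2 + b ^ 2 * 0 ^ 2 = 1 := by ring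
  rw [e1, e0, e2, e3, Real.arctan_neg, Real.arctan_inv_of_pos hb, Real.log_pow, Real.log_one]
  push_cast
  ring

theorem hasDerivAt_integral_arctan_div {b : ℝ} (hb : 0 < b) :
    HasDerivAt (fun b : ℝ => ∫ t in (0:ℝ)..1, Real.arctan (b * t / (1 - t)) / t)
      ((π / 2 * b - Real.log b) / (1 + b ^ 2)) b := by
  rw [← integral_one_sub_div hb]
  have hb2 : 0 < b / 2 := by linarith
  set c := (b / 2) ^ 2 / (1 + (b / 2) ^ 2) with hc
  have hcpos : 0 < c := by positivity
  refine (intervalIntegral.hasDerivAt_integral_of_dominated_loc_of_deriv_le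
    (F' := fun x t => (1 - t) / ((1 - t) ^ 2 + x ^ 2 * t ^ 2))
    (bound := fun _ => 1 / c) (Ioi_mem_nhds (by linarith : b / 2 < b))
    (Eventually.of_forall fun _ => aestronglyMeasurable_arctan_div _ _) ?_
    (continuous_one_sub_div hb).aestronglyMeasurable ?_ intervalIntegrable_const ?_).2
  · refine (intervalIntegrable_const (c := 2 * b + π)).mono_fun
      (aestronglyMeasurable_arctan_div _ _) ?_
    rw [EventuallyLE, ae_restrict_iff' measurableSet_uIoc]
    refine Eventually.of_forall fun t ht => ?_
    rw [uIoc_of_le zero_le_one] at ht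
    exact (norm_arctan_div_le hb.le ht).trans (le_abs_self _)
  · refine Eventually.of_forall fun t ht x hx => ?_
    rw [uIoc_of_le zero_le_one] at ht
    have hx' : b / 2 < x := hx
    have hD : c ≤ (1 - t) ^ 2 + x ^ 2 * t ^ 2 := by
      refine (div_one_add_sq_le (b / 2) t).trans ?_
      gcongr
    rw [Real.norm_of_nonneg (div_nonneg (by linarith [ht.2]) (hcpos.le.trans hD))]
    exact div_le_div₀ zero_le_one (by linarith [ht.1]) hcpos hD
  · filter_upwards [compl_mem_ae_iff.2 (measure_singleton (1:ℝ))] with t ht1 ht x hx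
    rw [uIoc_of_le zero_le_one] at ht
    have hx0 : 0 < x := hb2.trans hx
    have ht0 : t ≠ 0 := ht.1.ne'
    have ht1' : 1 - t ≠ 0 := sub_ne_zero.2 (Ne.symm ht1)
    have h1 : HasDerivAt (fun x : ℝ => x * t / (1 - t)) (1 * t / (1 - t)) x :=
      ((hasDerivAt_id x).mul_const t).div_const _
    refine (h1.arctan.div_const t).congr_deriv ?_
    have h4 : 1 + (x * t / (1 - t)) ^ 2 = ((1 - t) ^ 2 + x ^ 2 * t ^ 2) / (1 - t) ^ 2 := by
      field_simp
    rw [h4]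
    have h6 := (one_sub_sq_add_pos hx0 t).ne'
    field_simp

theorem continuous_arctan_mul_log : Continuous fun x : ℝ => Real.arctan x * Real.log x := by
  have h : (fun x : ℝ => Real.arctan x * Real.log x) =
      fun x => dslope Real.arctan 0 x * (x * Real.log x) := by
    funext x
    rcases eq_or_ne x 0 with rfl | hx
    · simp
    · rw [dslope_arctan_of_ne hx]
      field_simp
  rw [h]
  exact continuous_dslope_arctan.mul Real.continuous_mul_log

theorem stmt_2 (a : ℝ) (ha : 0 < a) :
    Ti2 a = Real.arctan a * Real.log a + (Li2 (1 + Complex.I * (a : ℂ))).im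
      - π / 4 * Real.log (1 + a ^ 2) := by
  rw [Li2_im_eq_integral ha.ne']
  set J : ℝ → ℝ := fun b => ∫ t in (0:ℝ)..1, Real.arctan (b * t / (1 - t)) / t with hJ
  have hlog : ∀ x : ℝ, HasDerivAt (fun x : ℝ => π / 4 * Real.log (1 + x ^ 2))
      (π / 4 * (2 * x / (1 + x ^ 2))) x := fun x => by
    have h : HasDerivAt (fun x : ℝ => 1 + x ^ 2) (2 * x) x := by
      simpa using ((hasDerivAt_id x).pow 2).const_add 1
    exact (h.log (by positivity)).const_mul _
  set F : ℝ → ℝ := fun b =>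
    Ti2 b - (Real.arctan b * Real.log b + J b - π / 4 * Real.log (1 + b ^ 2)) with hF
  have hcont : ContinuousOn F (Icc 0 a) := by
    refine ContinuousOn.sub (fun x _ => (hasDerivAt_Ti2 x).continuousAt.continuousWithinAt)
      (ContinuousOn.sub (continuous_arctan_mul_log.continuousOn.add
        (continuousOn_integral_arctan_div.mono Icc_subset_Ici_self))
        fun x _ => (hlog x).continuousAt.continuousWithinAt)
  have hder : ∀ x ∈ Ioo 0 a, HasDerivAt F 0 x := fun x hx => by
    have hx0 : x ≠ 0 := hx.1.ne'
    refine ((hasDerivAt_Ti2 x).sub ((((Real.hasDerivAt_arctan x).mul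
      (Real.hasDerivAt_log hx0)).add (hasDerivAt_integral_arctan_div hx.1)).sub
        (hlog x))).congr_deriv ?_
    rw [dslope_arctan_of_ne hx0]
    have : 1 + x ^ 2 ≠ 0 := by positivity
    field_simp
    ring
  obtain ⟨_, _, h⟩ := exists_hasDerivAt_eq_slope F (fun _ => 0) ha hcont hder
  have h0 : F 0 = 0 := by simp [hF, hJ, Ti2_zero]
  rw [h0, sub_zero, sub_zero, eq_comm, div_eq_zero_iff, or_iff_left ha.ne'] at h
  exact sub_eq_zero.1 h
end

section
/- Fix a > 0 and set φ_a(b) := I(a,b) − πb/2 + b²/2 for 0 ≤ b ≤ π. Then φ_a is differentiable on (0,π) with derivative φ_a′(b) = Arg(1 + a·e^{ib}), this derivative is strictly positive for all 0 < b < π, and consequently φ_a is strictly increasing on (0,π). -/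
open scoped Real

theorem intervalIntegrable_arctan_div_sin (a x y : ℝ) :
    IntervalIntegrable (fun β => Real.arctan ((a + Real.cos β) / Real.sin β))
      MeasureTheory.volume x y := by
  refine (intervalIntegrable_const (c := π / 2)).mono_fun ?_ ?_
  · exact Measurable.aestronglyMeasurable (by fun_prop)
  · refine Filter.Eventually.of_forall fun β => ?_
    refine le_trans ?_ (le_abs_self _)
    exact abs_le.2 ⟨(Real.neg_pi_div_two_lt_arctan _).le, (Real.arctan_lt_pi_div_two _).le⟩

theorem hasDerivAt_I (a : ℝ) {b : ℝ} (hb : b ∈ Set.Ioo (0 : ℝ) π) :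
    HasDerivAt (I a) (Real.arctan ((a + Real.cos b) / Real.sin b)) b := by
  have hs : Real.sin b ≠ 0 := (Real.sin_pos_of_mem_Ioo hb).ne'
  refine intervalIntegral.integral_hasDerivAt_right
    (intervalIntegrable_arctan_div_sin a 0 b) ?_ ?_
  · exact (Measurable.stronglyMeasurable (by fun_prop)).stronglyMeasurableAtFilter
  · exact Real.continuous_arctan.continuousAt.comp (by fun_prop (disch := exact hs))

theorem one_add_mul_exp_eq (a b : ℝ) :
    1 + (a : ℂ) * Complex.exp (Complex.I * (b : ℂ)) =
      ⟨1 + a * Real.cos b, a * Real.sin b⟩ := by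
  rw [mul_comm Complex.I, Complex.exp_mul_I]
  apply Complex.ext <;> simp [Complex.cos_ofReal_re, Complex.sin_ofReal_re]

theorem arg_one_add_mul_exp (a : ℝ) {b : ℝ} (hb : b ∈ Set.Ioo (0 : ℝ) π) :
    Complex.arg (1 + (a : ℂ) * Complex.exp (Complex.I * (b : ℂ))) =
      Real.arctan ((a + Real.cos b) / Real.sin b) - π / 2 + b := by
  have hs : 0 < Real.sin b := Real.sin_pos_of_mem_Ioo hb
  set t := (a + Real.cos b) / Real.sin b with ht
  have hts : t * Real.sin b = a + Real.cos b := div_mul_cancel₀ _ hs.ne'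
  have hq : 0 < √(1 + t ^ 2) := by positivity
  have hcos : √(1 + t ^ 2) * Real.cos (Real.arctan t) = 1 := by
    rw [Real.cos_arctan]; field_simp
  have hsin : √(1 + t ^ 2) * Real.sin (Real.arctan t) = t := by
    rw [Real.sin_arctan]; field_simp
  have hθ : Real.arctan t - π / 2 + b = Real.arctan t + b - π / 2 := by ring
  have hsq := Real.sin_sq_add_cos_sq b
  have hpolar : 1 + (a : ℂ) * Complex.exp (Complex.I * (b : ℂ)) =
      ((√(1 + t ^ 2) * Real.sin b : ℝ) : ℂ) *
        (Complex.cos ((Real.arctan t - π / 2 + b : ℝ) : ℂ) +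
          Complex.sin ((Real.arctan t - π / 2 + b : ℝ) : ℂ) * Complex.I) := by
    rw [one_add_mul_exp_eq, ← Complex.ofReal_cos, ← Complex.ofReal_sin, hθ,
      Real.cos_sub_pi_div_two, Real.sin_sub_pi_div_two, Real.sin_add, Real.cos_add]
    apply Complex.ext
    · simp only [Complex.re_ofReal_mul, Complex.add_re, Complex.ofReal_re, Complex.mul_I_re,
        Complex.ofReal_im]
      linear_combination (-Real.sin b * Real.cos b) * hsin - Real.sin b ^ 2 * hcos
        - Real.cos b * hts - hsq
    · simp only [Complex.im_ofReal_mul, Complex.add_im, Complex.ofReal_re, Complex.mul_I_im,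
        Complex.ofReal_im]
      linear_combination (-Real.sin b ^ 2) * hsin + Real.sin b * Real.cos b * hcos
        - Real.sin b * hts
  rw [hpolar]
  refine Complex.arg_mul_cos_add_sin_mul_I (by positivity) ⟨?_, ?_⟩
  · linarith [Real.neg_pi_div_two_lt_arctan t, hb.1]
  · linarith [Real.arctan_lt_pi_div_two t, hb.2]

theorem arg_one_add_mul_exp_pos {a b : ℝ} (ha : 0 < a) (hb : b ∈ Set.Ioo (0 : ℝ) π) :
    0 < Complex.arg (1 + (a : ℂ) * Complex.exp (Complex.I * (b : ℂ))) := by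
  have him : 0 < a * Real.sin b := mul_pos ha (Real.sin_pos_of_mem_Ioo hb)
  rw [one_add_mul_exp_eq]
  exact (Complex.arg_nonneg_iff.2 him.le).lt_of_ne' fun h =>
    him.ne' (Complex.arg_eq_zero_iff.1 h).2

theorem hasDerivAt_I_sub_add (a : ℝ) {b : ℝ} (hb : b ∈ Set.Ioo (0 : ℝ) π) :
    HasDerivAt (fun b => I a b - π * b / 2 + b ^ 2 / 2)
      (Complex.arg (1 + (a : ℂ) * Complex.exp (Complex.I * (b : ℂ)))) b := by
  rw [arg_one_add_mul_exp a hb]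
  refine HasDerivAt.congr_deriv (((hasDerivAt_I a hb).sub
    (((hasDerivAt_id b).const_mul π).div_const 2)).add
      (((hasDerivAt_id b).pow 2).div_const 2)) ?_
  simp

theorem stmt_3 (a : ℝ) (ha : 0 < a) :
    (∀ b ∈ Set.Ioo (0:ℝ) π,
        HasDerivAt (fun b => I a b - π * b / 2 + b ^ 2 / 2)
          (Complex.arg (1 + (a : ℂ) * Complex.exp (Complex.I * (b : ℂ)))) b ∧
        0 < Complex.arg (1 + (a : ℂ) * Complex.exp (Complex.I * (b : ℂ)))) ∧
    StrictMonoOn (fun b => I a b - π * b / 2 + b ^ 2 / 2) (Set.Ioo (0:ℝ) π) := by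
  refine ⟨fun b hb => ⟨hasDerivAt_I_sub_add a hb, arg_one_add_mul_exp_pos ha hb⟩, ?_⟩
  refine strictMonoOn_of_deriv_pos (convex_Ioo 0 π)
    (fun b hb => (hasDerivAt_I_sub_add a hb).continuousAt.continuousWithinAt) fun b hb => ?_
  rw [interior_Ioo] at hb
  rw [(hasDerivAt_I_sub_add a hb).deriv]
  exact arg_one_add_mul_exp_pos ha hb
end

section
/- Fix a > 0 and set φ_a(b) := I(a,b) − πb/2 + b²/2. Then φ_a(0) = 0 and the limit of φ_a(b) as b → π⁻ equals Re(Li₂(a)) − Li₂(−a), where Re(Li₂(a)) is understood as the boundary value of Re(Li₂(−a·e^{ib})) as b → π⁻ (which for 0 < a ≤ 1 is the value Li₂(a) of the real dilogarithm, and for a > 1 is the real part of either boundary value on the cut). -/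
open scoped Real

open MeasureTheory Set

theorem norm_clog_one_sub_div_le (c : ℝ) {t : ℝ} (ht : 0 < t) :
    ‖Complex.log (1 - (c : ℂ) * (t : ℂ)) / (t : ℂ)‖ ≤
      3 / 2 * |c| + 2 * |c| * (|Real.log (1 - c * t)| + π) := by
  have hπ := Real.pi_pos
  have hlog : 0 ≤ |Real.log (1 - c * t)| := abs_nonneg _
  have hc : 0 ≤ |c| := abs_nonneg _
  have hn : ‖-((c : ℂ) * (t : ℂ))‖ = |c| * t := by
    rw [norm_neg, norm_mul, Complex.norm_real, Complex.norm_real, Real.norm_eq_abs,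
      Real.norm_eq_abs, abs_of_pos ht]
  rw [norm_div, Complex.norm_real, Real.norm_eq_abs, abs_of_pos ht, div_le_iff₀ ht]
  rcases le_or_gt (|c| * t) (1 / 2) with h | h
  · have h1 := Complex.norm_log_one_add_half_le_self (hn.trans_le h)
    rw [← sub_eq_add_neg, hn] at h1
    have : 0 ≤ 2 * |c| * (|Real.log (1 - c * t)| + π) * t := by positivity
    nlinarith
  · have h1 : ‖Complex.log (1 - (c : ℂ) * (t : ℂ))‖ ≤ |Real.log (1 - c * t)| + π := by
      refine (Complex.norm_le_abs_re_add_abs_im _).trans (add_le_add ?_ ?_)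
      · have : (1 - (c : ℂ) * (t : ℂ)) = ((1 - c * t : ℝ) : ℂ) := by push_cast; rfl
        rw [this, Complex.log_ofReal_re]
      · rw [Complex.log_im]
        exact Complex.abs_arg_le_pi _
    have : 0 ≤ 3 / 2 * |c| * t := by positivity
    linear_combination h1 + this +
      2 * mul_nonneg (add_nonneg hlog hπ.le) (sub_nonneg.2 h.le)

theorem intervalIntegrable_log_one_sub_mul (c : ℝ) :
    IntervalIntegrable (fun t => Real.log (1 - c * t)) volume 0 1 := by
  rcases eq_or_ne c 0 with rfl | hc
  · simp
  · have h : IntervalIntegrable Real.log volume (1 - c * 0) (1 - c * 1) :=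
      intervalIntegral.intervalIntegrable_log'
    have h2 := (h.comp_sub_left 1).comp_mul_left (c := c)
    simpa [hc] using h2

theorem intervalIntegrable_clog_one_sub_div (c : ℝ) :
    IntervalIntegrable (fun t : ℝ => Complex.log (1 - (c : ℂ) * (t : ℂ)) / (t : ℂ))
      volume 0 1 := by
  have hg : IntervalIntegrable
      (fun t => 3 / 2 * |c| + 2 * |c| * (|Real.log (1 - c * t)| + π)) volume 0 1 :=
    intervalIntegrable_const.add
      (((intervalIntegrable_log_one_sub_mul c).abs.add intervalIntegrable_const).const_mul _)
  refine hg.mono_fun' (Measurable.aestronglyMeasurable (by fun_prop)) ?_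
  rw [uIoc_of_le zero_le_one]
  filter_upwards [ae_restrict_mem measurableSet_Ioc] with t ht
  exact norm_clog_one_sub_div_le c ht.1

theorem re_clog_one_sub_div (c t : ℝ) :
    (Complex.log (1 - (c : ℂ) * (t : ℂ)) / (t : ℂ)).re = Real.log (1 - c * t) / t := by
  have : (1 - (c : ℂ) * (t : ℂ)) = ((1 - c * t : ℝ) : ℂ) := by push_cast; rfl
  rw [Complex.div_ofReal_re, this, Complex.log_ofReal_re]

theorem intervalIntegrable_log_one_sub_div (c : ℝ) :
    IntervalIntegrable (fun t => Real.log (1 - c * t) / t) volume 0 1 := by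
  have h := intervalIntegrable_clog_one_sub_div c
  rw [intervalIntegrable_iff] at h ⊢
  simpa only [IntegrableOn, RCLike.re_to_complex, re_clog_one_sub_div] using h.re

theorem Li2_ofReal_re (c : ℝ) :
    (Li2 (c : ℂ)).re = -∫ t in (0:ℝ)..1, Real.log (1 - c * t) / t := by
  have h := Complex.reCLM.intervalIntegral_comp_comm (intervalIntegrable_clog_one_sub_div c)
  simp only [Complex.reCLM_apply, re_clog_one_sub_div] at h
  rw [Li2, Complex.neg_re, h]

theorem intervalIntegrable_arctan_comp {f : ℝ → ℝ} (hf : Measurable f) (x y : ℝ) :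
    IntervalIntegrable (fun β => Real.arctan (f β)) volume x y := by
  refine (intervalIntegrable_const (c := π / 2)).mono_fun'
    (Real.measurable_arctan.comp hf).aestronglyMeasurable (.of_forall fun β => ?_)
  exact (abs_lt.2 ⟨Real.neg_pi_div_two_lt_arctan _, Real.arctan_lt_pi_div_two _⟩).le

theorem I_zero_pi : I 0 π = 0 := by
  have h := intervalIntegral.integral_comp_sub_left
    (fun β => Real.arctan ((0 + Real.cos β) / Real.sin β)) π (a := 0) (b := π)
  simp only [Real.cos_pi_sub, Real.sin_pi_sub, zero_add, neg_div, Real.arctan_neg, sub_self,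
    sub_zero, intervalIntegral.integral_neg] at h
  simp only [I, zero_add]
  linarith

theorem one_add_two_mul_cos_add_sq (x β : ℝ) :
    1 + 2 * x * Real.cos β + x ^ 2 = (x + Real.cos β) ^ 2 + Real.sin β ^ 2 := by
  rw [Real.sin_sq]; ring

theorem integral_poisson_eq_arctan_sub (a : ℝ) {β : ℝ} (hβ : 0 < Real.sin β) :
    ∫ t in (0:ℝ)..1, a * Real.sin β / (1 + 2 * (a * t) * Real.cos β + (a * t) ^ 2) =
      Real.arctan ((a + Real.cos β) / Real.sin β) -
        Real.arctan ((0 + Real.cos β) / Real.sin β) := by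
  have hpos (t : ℝ) : 0 < 1 + 2 * (a * t) * Real.cos β + (a * t) ^ 2 := by
    rw [one_add_two_mul_cos_add_sq]; positivity
  have hd (t : ℝ) : HasDerivAt (fun t => Real.arctan ((a * t + Real.cos β) / Real.sin β))
      (a * Real.sin β / (1 + 2 * (a * t) * Real.cos β + (a * t) ^ 2)) t := by
    have h := ((((hasDerivAt_id t).const_mul a).add_const (Real.cos β)).div_const
      (Real.sin β)).arctan
    refine h.congr_deriv ?_
    have h1 := (hpos t).ne'
    rw [one_add_two_mul_cos_add_sq] at h1 ⊢
    simp only [id]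
    field_simp
    ring
  rw [intervalIntegral.integral_eq_sub_of_hasDerivAt (fun t _ => hd t)]
  · simp
  · refine Continuous.intervalIntegrable ?_ _ _
    exact Continuous.div (by fun_prop) (by fun_prop) fun t => (hpos t).ne'

theorem integral_poisson_eq_log_sub {a t : ℝ} (ha : 0 < a) (ht : 0 < t) (h1 : a * t ≠ 1) :
    ∫ β in (0:ℝ)..π, a * Real.sin β / (1 + 2 * (a * t) * Real.cos β + (a * t) ^ 2) =
      Real.log (1 - (-a) * t) / t - Real.log (1 - a * t) / t := by
  have hat : 0 < a * t := mul_pos ha ht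
  have hpos (β : ℝ) : 0 < 1 + 2 * (a * t) * Real.cos β + (a * t) ^ 2 := by
    have : 0 < (1 - a * t) ^ 2 := by
      have := sub_ne_zero.2 h1.symm
      positivity
    nlinarith [Real.neg_one_le_cos β]
  have hd (β : ℝ) : HasDerivAt
      (fun β => -(Real.log (1 + 2 * (a * t) * Real.cos β + (a * t) ^ 2) / (2 * t)))
      (a * Real.sin β / (1 + 2 * (a * t) * Real.cos β + (a * t) ^ 2)) β := by
    have h := (((((Real.hasDerivAt_cos β).const_mul (2 * (a * t))).const_add 1).add_const
      ((a * t) ^ 2)).log (hpos β).ne').div_const (2 * t) |>.neg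
    refine h.congr_deriv ?_
    have := (hpos β).ne'
    field_simp
  rw [intervalIntegral.integral_eq_sub_of_hasDerivAt (fun t _ => hd t)]
  · have e1 : 1 + 2 * (a * t) * Real.cos π + (a * t) ^ 2 = (1 - a * t) ^ 2 := by
      rw [Real.cos_pi]; ring
    have e2 : 1 + 2 * (a * t) * Real.cos 0 + (a * t) ^ 2 = (1 - (-a) * t) ^ 2 := by
      rw [Real.cos_zero]; ring
    rw [e1, e2, Real.log_pow, Real.log_pow]
    push_cast
    field_simp
    ring
  · refine Continuous.intervalIntegrable ?_ _ _
    exact Continuous.div (by fun_prop) (by fun_prop) fun t => (hpos t).ne'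

theorem integrable_poisson_prod {a : ℝ} (ha : 0 < a) :
    Integrable (Function.uncurry fun β t : ℝ =>
      a * Real.sin β / (1 + 2 * (a * t) * Real.cos β + (a * t) ^ 2))
      ((volume.restrict (Ioo 0 π)).prod (volume.restrict (Ioc 0 1))) := by
  have hmeas : Measurable (Function.uncurry fun β t : ℝ =>
      a * Real.sin β / (1 + 2 * (a * t) * Real.cos β + (a * t) ^ 2)) := by
    unfold Function.uncurry; fun_prop
  rw [integrable_prod_iff hmeas.aestronglyMeasurable]
  constructor
  · filter_upwards [ae_restrict_mem measurableSet_Ioo] with β hβ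
    have hs := Real.sin_pos_of_mem_Ioo hβ
    refine Continuous.integrableOn_Ioc (μ := volume) (a := (0:ℝ)) (b := 1) ?_
    refine Continuous.div (by fun_prop) (by fun_prop) fun t => ?_
    rw [one_add_two_mul_cos_add_sq]; positivity
  · have hint (c : ℝ) : IntegrableOn (fun β => Real.arctan ((c + Real.cos β) / Real.sin β))
        (Ioo 0 π) :=
      (intervalIntegrable_iff_integrableOn_Ioo_of_le Real.pi_pos.le).1
        (intervalIntegrable_arctan_comp (by fun_prop) 0 π)
    refine ((hint a).sub (hint 0)).congr ?_
    filter_upwards [ae_restrict_mem measurableSet_Ioo] with β hβ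
    have hs := Real.sin_pos_of_mem_Ioo hβ
    simp only [Pi.sub_apply]
    rw [← integral_poisson_eq_arctan_sub a hs, intervalIntegral.integral_of_le zero_le_one]
    refine integral_congr_ae (.of_forall fun t => ?_)
    refine (Real.norm_of_nonneg ?_).symm
    beta_reduce
    rw [one_add_two_mul_cos_add_sq]; positivity

theorem I_pi_eq {a : ℝ} (ha : 0 < a) : I a π = (Li2 (a : ℂ)).re - (Li2 (-(a : ℂ))).re := by
  have hI (c : ℝ) := intervalIntegrable_arctan_comp
    (f := fun β => (c + Real.cos β) / Real.sin β) (by fun_prop) 0 π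
  calc I a π = I a π - I 0 π := by rw [I_zero_pi, sub_zero]
    _ = ∫ β in Ioo 0 π, ∫ t in Ioc (0:ℝ) 1,
          a * Real.sin β / (1 + 2 * (a * t) * Real.cos β + (a * t) ^ 2) := by
      rw [I, I, ← intervalIntegral.integral_sub (hI a) (hI 0),
        intervalIntegral.integral_of_le Real.pi_pos.le, integral_Ioc_eq_integral_Ioo]
      refine setIntegral_congr_fun measurableSet_Ioo fun β hβ => ?_
      rw [← integral_poisson_eq_arctan_sub a (Real.sin_pos_of_mem_Ioo hβ),
        intervalIntegral.integral_of_le zero_le_one]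
    _ = ∫ t in Ioc (0:ℝ) 1, ∫ β in Ioo 0 π,
          a * Real.sin β / (1 + 2 * (a * t) * Real.cos β + (a * t) ^ 2) :=
      integral_integral_swap (integrable_poisson_prod ha)
    _ = ∫ t in Ioc (0:ℝ) 1, (Real.log (1 - (-a) * t) / t - Real.log (1 - a * t) / t) := by
      refine integral_congr_ae ?_
      have hne : ∀ᵐ t : ℝ ∂volume.restrict (Ioc 0 1), t ≠ 1 / a :=
        ae_restrict_of_ae (Measure.ae_ne volume _)
      filter_upwards [ae_restrict_mem measurableSet_Ioc, hne] with t ht hta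
      rw [← integral_Ioc_eq_integral_Ioo, ← intervalIntegral.integral_of_le Real.pi_pos.le]
      refine integral_poisson_eq_log_sub ha ht.1 fun h => hta ?_
      rw [eq_div_iff ha.ne', mul_comm, h]
    _ = (Li2 (a : ℂ)).re - (Li2 (-(a : ℂ))).re := by
      rw [← intervalIntegral.integral_of_le zero_le_one,
        intervalIntegral.integral_sub (intervalIntegrable_log_one_sub_div (-a))
          (intervalIntegrable_log_one_sub_div a), ← Complex.ofReal_neg, Li2_ofReal_re,
        Li2_ofReal_re]
      ring

theorem continuous_I (a : ℝ) : Continuous (I a) :=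
  intervalIntegral.continuous_primitive (fun x y => intervalIntegrable_arctan_comp
    (f := fun β => (a + Real.cos β) / Real.sin β) (by fun_prop) x y) 0

theorem stmt_4 (a : ℝ) (ha : 0 < a) :
    (I a 0 - π * 0 / 2 + (0:ℝ) ^ 2 / 2 = 0) ∧
    Filter.Tendsto (fun b => I a b - π * b / 2 + b ^ 2 / 2)
      (nhdsWithin π (Set.Iio π))
      (nhds ((Li2 (a : ℂ)).re - (Li2 (-(a : ℂ))).re)) := by
  refine ⟨by simp [I], ?_⟩
  have hI := continuous_I a
  have hcont : Continuous fun b => I a b - π * b / 2 + b ^ 2 / 2 := by fun_prop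
  have h := (hcont.tendsto π).mono_left (nhdsWithin_le_nhds (s := Set.Iio π))
  have hval : I a π - π * π / 2 + π ^ 2 / 2 = (Li2 (a : ℂ)).re - (Li2 (-(a : ℂ))).re := by
    rw [I_pi_eq ha]; ring
  rwa [hval] at h
end

section
/- Let a > 0, let ψ(a) := Im(Li₂(1 + i·a)) and φ_a(b) := I(a,b) − πb/2 + b²/2 for 0 ≤ b ≤ π. If 0 < ψ(a) < φ_a(π) (where φ_a(π) denotes the limit of φ_a(b) as b → π⁻), then there exists a unique b(a) ∈ (0,π) such that φ_a(b(a)) = ψ(a). -/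
open scoped Real

theorem intervalIntegrable_arctan_angle (a b c : ℝ) :
    IntervalIntegrable (fun β => Real.arctan ((a + Real.cos β) / Real.sin β))
      MeasureTheory.volume b c := by
  refine (intervalIntegrable_const (c := π / 2)).mono_fun ?_ ?_
  · exact Measurable.aestronglyMeasurable (by fun_prop)
  · refine Filter.Eventually.of_forall fun β => ?_
    beta_reduce
    rw [Real.norm_eq_abs, Real.norm_eq_abs, abs_of_pos Real.pi_div_two_pos]
    exact abs_le.2 ⟨(Real.neg_pi_div_two_lt_arctan _).le, (Real.arctan_lt_pi_div_two _).le⟩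

theorem pi_div_two_sub_lt_arctan_angle {a β : ℝ} (ha : 0 < a) (hβ : β ∈ Set.Ioo 0 π) :
    π / 2 - β < Real.arctan ((a + Real.cos β) / Real.sin β) := by
  have hs : 0 < Real.sin β := Real.sin_pos_of_mem_Ioo hβ
  have hcot : Real.arctan (Real.cos β / Real.sin β) = π / 2 - β := by
    rw [← Real.arctan_tan (x := π / 2 - β) (by linarith [hβ.2]) (by linarith [hβ.1]),
      Real.tan_eq_sin_div_cos, Real.sin_pi_div_two_sub, Real.cos_pi_div_two_sub]
  rw [← hcot]
  refine Real.arctan_strictMono ?_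
  gcongr
  linarith

theorem strictMonoOn_I_sub_add {a : ℝ} (ha : 0 < a) :
    StrictMonoOn (fun b => I a b - π * b / 2 + b ^ 2 / 2) (Set.Icc 0 π) := by
  intro b hb c hc hbc
  have hpos : 0 < ∫ β in b..c,
      (Real.arctan ((a + Real.cos β) / Real.sin β) - (π / 2 - β)) := by
    refine intervalIntegral.intervalIntegral_pos_of_pos_on
      ((intervalIntegrable_arctan_angle a b c).sub
        (Continuous.intervalIntegrable (by fun_prop) _ _)) (fun β hβ => ?_) hbc
    exact sub_pos.2
      (pi_div_two_sub_lt_arctan_angle ha ⟨hb.1.trans_lt hβ.1, hβ.2.trans_le hc.2⟩)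
  rw [intervalIntegral.integral_sub (intervalIntegrable_arctan_angle a b c)
      (Continuous.intervalIntegrable (by fun_prop) _ _),
    intervalIntegral.integral_sub (by simp) (by simp),
    intervalIntegral.integral_const, integral_id, smul_eq_mul,
    ← intervalIntegral.integral_interval_sub_left (intervalIntegrable_arctan_angle a 0 c)
      (intervalIntegrable_arctan_angle a 0 b)] at hpos
  simp only [I]
  linarith

theorem continuous_I_sub_add (a : ℝ) :
    Continuous (fun b => I a b - π * b / 2 + b ^ 2 / 2) := by
  have h : Continuous (I a) :=
    intervalIntegral.continuous_primitive (intervalIntegrable_arctan_angle a) 0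
  fun_prop

theorem stmt_5 (a : ℝ) (ha : 0 < a) (L : ℝ)
    (hL : Filter.Tendsto (fun b => I a b - π * b / 2 + b ^ 2 / 2)
      (nhdsWithin π (Set.Iio π)) (nhds L))
    (hψ0 : 0 < (Li2 (1 + Complex.I * (a : ℂ))).im)
    (hψL : (Li2 (1 + Complex.I * (a : ℂ))).im < L) :
    ∃! b, b ∈ Set.Ioo (0:ℝ) π ∧
      I a b - π * b / 2 + b ^ 2 / 2 = (Li2 (1 + Complex.I * (a : ℂ))).im := by
  have hc := continuous_I_sub_add a
  have hL' : L = I a π - π * π / 2 + π ^ 2 / 2 :=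
    tendsto_nhds_unique hL (hc.continuousAt.tendsto.mono_left nhdsWithin_le_nhds)
  have h0 : I a 0 - π * 0 / 2 + 0 ^ 2 / 2 = 0 := by simp [I]
  obtain ⟨b, hb, hbψ⟩ := intermediate_value_Ioo Real.pi_pos.le hc.continuousOn
    (show (Li2 (1 + Complex.I * (a : ℂ))).im ∈ Set.Ioo _ _ from
      ⟨h0.trans_lt hψ0, hψL.trans_eq hL'⟩)
  exact ⟨b, ⟨hb, hbψ⟩, fun c hc => (strictMonoOn_I_sub_add ha).injOn
    (Set.Ioo_subset_Icc_self hc.1) (Set.Ioo_subset_Icc_self hb) (hc.2.trans hbψ.symm)⟩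
end

section
/- Let 0 < α < π and A > 0, and set H(A,α) := ∫₀^A arctan(cot(α)·tanh(x))/x dx. Then Ti₂(A/α) = H(A,α) + Σ_{k=1}^∞ [ Ti₂(A/(kπ − α)) − Ti₂(A/(kπ + α)) ], where the series converges. -/
open scoped Real

open MeasureTheory

theorem hasDerivAt_arctan_div {a : ℝ} (ha : a ≠ 0) (x : ℝ) :
    HasDerivAt (fun t : ℝ => Real.arctan (t / a)) (a / (a ^ 2 + x ^ 2)) x := by
  have h := ((hasDerivAt_id x).div_const a).arctan
  convert h using 1
  have h1 : a ^ 2 + x ^ 2 ≠ 0 := by positivity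
  simp only [id]
  field_simp
  rfl

theorem hasDerivAt_arctan_cot_mul_tanh {α : ℝ} (hα : Real.sin α ≠ 0) (x : ℝ) :
    HasDerivAt (fun t : ℝ => Real.arctan (Real.cot α * Real.tanh t))
      (Real.sin α * Real.cos α / (Real.sin α ^ 2 + Real.sinh x ^ 2)) x := by
  have hc := (Real.cosh_pos x).ne'
  have h := (((Real.hasDerivAt_sinh x).div (Real.hasDerivAt_cosh x) hc).const_mul
    (Real.cot α)).arctan
  have hf : (fun t : ℝ => Real.arctan (Real.cot α * Real.tanh t)) =
      fun t => Real.arctan (Real.cot α * (Real.sinh / Real.cosh) t) := by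
    funext t
    rw [Real.tanh_eq_sinh_div_cosh, Pi.div_apply]
  rw [hf]
  convert h using 1
  have h1 : Real.sin α ^ 2 + Real.sinh x ^ 2 ≠ 0 := by positivity
  have h2 : Real.sin α ^ 2 * Real.cosh x ^ 2 + Real.cos α ^ 2 * Real.sinh x ^ 2 =
      Real.sin α ^ 2 + Real.sinh x ^ 2 := by
    rw [Real.cosh_sq, Real.cos_sq']
    ring
  rw [Pi.div_apply, Real.cot_eq_cos_div_sin, ← h2]
  rw [← h2] at h1
  field_simp
  rw [Real.cosh_sq]
  ring

theorem hasSum_re_cot {α : ℝ} (hα0 : 0 < α) (hαπ : α < π) (x : ℝ) :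
    HasSum (fun k : ℕ => (((k : ℝ) + 1) * π - α) / ((((k : ℝ) + 1) * π - α) ^ 2 + x ^ 2) -
        (((k : ℝ) + 1) * π + α) / ((((k : ℝ) + 1) * π + α) ^ 2 + x ^ 2))
      (α / (α ^ 2 + x ^ 2) -
        Real.sin α * Real.cos α / (Real.sin α ^ 2 + Real.sinh x ^ 2)) := by
  have hsin : Real.sin α ≠ 0 := (Real.sin_pos_of_pos_of_lt_pi hα0 hαπ).ne'
  have hπ : (π : ℂ) ≠ 0 := by exact_mod_cast Real.pi_ne_zero
  set z : ℂ := α + x * Complex.I with hz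
  have hmem : z / π ∈ Complex.integerComplement := by
    rw [Complex.mem_integerComplement_iff]
    rintro ⟨n, hn⟩
    have h1 : z = n * π := by rw [hn]; field_simp
    have h2 : α = n * π := by simpa [hz] using congrArg Complex.re h1
    have h3 : 0 < n := by
      by_contra! hle
      have : (n : ℝ) ≤ 0 := by exact_mod_cast hle
      nlinarith [Real.pi_pos]
    have h4 : (1 : ℝ) ≤ n := by exact_mod_cast h3
    nlinarith [Real.pi_pos]
  have hs := (summable_cotTerm hmem).hasSum
  have ht := cot_series_rep' hmem
  simp only [cotTerm] at hs
  rw [← ht, mul_div_cancel₀ _ hπ] at hs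
  have hre := Complex.hasSum_re (hs.mul_left (-1 / (π : ℂ)))
  convert hre using 1
  · funext k
    have e1 : -1 / (π : ℂ) * (1 / (z / π - (k + 1)) + 1 / (z / π + (k + 1))) =
        -(z - ((((k : ℝ) + 1) * π : ℝ) : ℂ))⁻¹ - (z + ((((k : ℝ) + 1) * π : ℝ) : ℂ))⁻¹ := by
      rw [div_sub' hπ, div_add' _ _ _ hπ]
      push_cast
      rw [one_div_div, one_div_div, mul_add, mul_comm (π : ℂ)]
      field_simp
      ring
    rw [e1]
    simp only [Complex.sub_re, Complex.neg_re, Complex.inv_re, Complex.normSq_apply, hz]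
    simp
    ring
  · have e2 : -1 / (π : ℂ) * (π * Complex.cot z - 1 / (z / π)) = z⁻¹ - Complex.cot z := by
      field_simp
      ring
    rw [e2, Complex.sub_re, Complex.inv_re, Complex.cot_eq_cos_div_sin, hz,
      Complex.cos_add_mul_I, Complex.sin_add_mul_I, Complex.div_re, Complex.normSq_apply,
      Complex.normSq_apply]
    simp only [← Complex.ofReal_sin, ← Complex.ofReal_cos, ← Complex.ofReal_sinh,
      ← Complex.ofReal_cosh]
    simp [-Complex.ofReal_sin, -Complex.ofReal_cos, -Complex.ofReal_sinh,
      -Complex.ofReal_cosh]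
    have h2 : Real.sin α * Real.cosh x * (Real.sin α * Real.cosh x) +
        Real.cos α * Real.sinh x * (Real.cos α * Real.sinh x) =
        Real.sin α ^ 2 + Real.sinh x ^ 2 := by
      linear_combination Real.sin α ^ 2 * Real.cosh_sq x + Real.sinh x ^ 2 * Real.cos_sq' α
    rw [h2, ← add_div]
    congr 2
    · ring
    · linear_combination (Real.sin α * Real.cos α) * -Real.cosh_sq x

theorem abs_div_sub_div_le {a b : ℝ} (ha : 0 < a) (hab : a ≤ b) (x : ℝ) :
    |a / (a ^ 2 + x ^ 2) - b / (b ^ 2 + x ^ 2)| ≤ (b - a) / (a * b) := by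
  have hb : 0 < b := ha.trans_le hab
  have e : a / (a ^ 2 + x ^ 2) - b / (b ^ 2 + x ^ 2) =
      (b - a) * ((a * b - x ^ 2) / ((a ^ 2 + x ^ 2) * (b ^ 2 + x ^ 2))) := by
    field_simp
    ring
  rw [e, abs_mul, abs_of_nonneg (sub_nonneg.2 hab), div_eq_mul_inv (b - a)]
  refine mul_le_mul_of_nonneg_left ?_ (sub_nonneg.2 hab)
  rw [abs_div, abs_of_pos (by positivity : 0 < (a ^ 2 + x ^ 2) * (b ^ 2 + x ^ 2)),
    div_le_iff₀ (by positivity), ← div_eq_inv_mul, le_div_iff₀ (by positivity)]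
  have h : |a * b - x ^ 2| ≤ a * b + x ^ 2 := by
    rw [abs_le]
    constructor <;> nlinarith [sq_nonneg x, mul_pos ha hb]
  refine (mul_le_mul_of_nonneg_right h (by positivity)).trans ?_
  nlinarith [sq_nonneg (a * x), sq_nonneg (b * x), sq_nonneg ((a - b) * x), sq_nonneg (x ^ 2),
    mul_nonneg (mul_pos ha hb).le (sq_nonneg x)]

theorem abs_sub_le_of_hasDerivAt_of_bound {f f' : ℝ → ℝ} {C : ℝ}
    (hf : ∀ x, HasDerivAt f (f' x) x) (hC : ∀ x, |f' x| ≤ C) (h0 : f 0 = 0) (x : ℝ) :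
    |f x| ≤ C * |x| := by
  have := convex_univ.norm_image_sub_le_of_norm_hasDerivWithin_le
    (fun y _ => (hf y).hasDerivWithinAt) (fun y _ => hC y) (Set.mem_univ 0) (Set.mem_univ x)
  simpa [h0] using this

theorem abs_arctan_div_sub_arctan_div_le {a b : ℝ} (ha : 0 < a) (hab : a ≤ b) (x : ℝ) :
    |Real.arctan (x / a) - Real.arctan (x / b)| ≤ (b - a) / (a * b) * |x| :=
  abs_sub_le_of_hasDerivAt_of_bound
    (f := fun t => Real.arctan (t / a) - Real.arctan (t / b))
    (fun y => (hasDerivAt_arctan_div ha.ne' y).sub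
      (hasDerivAt_arctan_div (ha.trans_le hab).ne' y))
    (abs_div_sub_div_le ha hab) (by simp) x

theorem intervalIntegrable_div_id {f : ℝ → ℝ} {C : ℝ} (hf : Continuous f)
    (hC : ∀ x, |f x| ≤ C * |x|) (a b : ℝ) :
    IntervalIntegrable (fun x => f x / x) volume a b := by
  refine (intervalIntegrable_const (c := C)).mono_fun
    (hf.measurable.div measurable_id).aestronglyMeasurable (Filter.Eventually.of_forall fun x => ?_)
  have hC0 : 0 ≤ C := by simpa using (abs_nonneg _).trans (hC 1)
  simp only [Real.norm_eq_abs, abs_div, abs_of_nonneg hC0]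
  exact div_le_of_le_mul₀ (abs_nonneg _) hC0 (hC x)

theorem intervalIntegrable_arctan_div_div {c : ℝ} (hc : 0 < c) (a b : ℝ) :
    IntervalIntegrable (fun x => Real.arctan (x / c) / x) volume a b := by
  refine intervalIntegrable_div_id (C := 1 / c) (by fun_prop) ?_ a b
  refine abs_sub_le_of_hasDerivAt_of_bound (hasDerivAt_arctan_div hc.ne') (fun x => ?_) (by simp)
  rw [abs_of_pos (by positivity), div_le_div_iff₀ (by positivity) hc]
  nlinarith [sq_nonneg x]

theorem continuous_arctan_cot_mul_tanh {α : ℝ} (hα : Real.sin α ≠ 0) :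
    Continuous fun t : ℝ => Real.arctan (Real.cot α * Real.tanh t) :=
  continuous_iff_continuousAt.2 fun x => (hasDerivAt_arctan_cot_mul_tanh hα x).continuousAt

theorem intervalIntegrable_arctan_cot_mul_tanh_div {α : ℝ} (hα : Real.sin α ≠ 0) (a b : ℝ) :
    IntervalIntegrable (fun x => Real.arctan (Real.cot α * Real.tanh x) / x) volume a b := by
  refine intervalIntegrable_div_id (C := |Real.sin α * Real.cos α| / Real.sin α ^ 2)
    (continuous_arctan_cot_mul_tanh hα) ?_ a b
  refine abs_sub_le_of_hasDerivAt_of_bound (hasDerivAt_arctan_cot_mul_tanh hα) (fun x => ?_)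
    (by simp)
  rw [abs_div, abs_of_pos (by positivity : 0 < Real.sin α ^ 2 + Real.sinh x ^ 2)]
  gcongr
  nlinarith [sq_nonneg (Real.sinh x)]

theorem Ti2_div {c : ℝ} (hc : 0 < c) (A : ℝ) :
    Ti2 (A / c) = ∫ x in (0:ℝ)..A, Real.arctan (x / c) / x := by
  have h := intervalIntegral.inv_mul_integral_comp_div (a := 0) (b := A)
    (f := fun x => Real.arctan x / x) (c := c)
  rw [zero_div] at h
  rw [Ti2, ← h, ← intervalIntegral.integral_const_mul]
  congr 1
  funext x
  rcases eq_or_ne x 0 with rfl | hx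
  · simp
  · field_simp

theorem summable_pole_gap {α : ℝ} (hα0 : 0 < α) (hαπ : α < π) :
    Summable fun k : ℕ => ((((k : ℝ) + 1) * π + α) - (((k : ℝ) + 1) * π - α)) /
      ((((k : ℝ) + 1) * π - α) * (((k : ℝ) + 1) * π + α)) := by
  have hs : Summable fun k : ℕ => 2 * α / (π ^ 2 - α ^ 2) * (1 / ((k : ℝ) + 1) ^ 2) := by
    have := (summable_nat_add_iff 1).2 (Real.summable_one_div_nat_pow.2 one_lt_two)
    simpa using this.mul_left (2 * α / (π ^ 2 - α ^ 2))
  have hpos : 0 < π ^ 2 - α ^ 2 := by nlinarith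
  refine hs.of_nonneg_of_le (fun k => ?_) fun k => ?_
  · have hk : (0 : ℝ) ≤ k := k.cast_nonneg
    have h1 : 0 < ((k : ℝ) + 1) * π - α := by nlinarith
    have h2 : 0 < ((k : ℝ) + 1) * π + α := by nlinarith
    exact div_nonneg (by linarith) (mul_pos h1 h2).le
  · have hk : (0 : ℝ) ≤ k := k.cast_nonneg
    rw [div_mul_div_comm, mul_one]
    have e : ((k : ℝ) + 1) * π + α - (((k : ℝ) + 1) * π - α) = 2 * α := by ring
    rw [e]
    refine div_le_div_of_nonneg_left (by positivity) (by positivity) ?_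
    nlinarith [mul_nonneg hk (sq_nonneg α), mul_nonneg (mul_nonneg hk hk) (sq_nonneg α)]

theorem pole_pos {α : ℝ} (hαπ : α < π) (k : ℕ) : 0 < ((k : ℝ) + 1) * π - α := by
  nlinarith [Real.pi_pos, mul_nonneg k.cast_nonneg (α := ℝ) Real.pi_pos.le]

theorem hasSum_arctan_sub_arctan {α : ℝ} (hα0 : 0 < α) (hαπ : α < π) (x : ℝ) :
    HasSum (fun k : ℕ => Real.arctan (x / (((k : ℝ) + 1) * π - α)) -
        Real.arctan (x / (((k : ℝ) + 1) * π + α)))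
      (Real.arctan (x / α) - Real.arctan (Real.cot α * Real.tanh x)) := by
  have hsin : Real.sin α ≠ 0 := (Real.sin_pos_of_pos_of_lt_pi hα0 hαπ).ne'
  have ha := pole_pos hαπ
  have hab (k : ℕ) : ((k : ℝ) + 1) * π - α ≤ ((k : ℝ) + 1) * π + α := by linarith
  have hb (k : ℕ) := (ha k).trans_le (hab k)
  have hc {c : ℝ} (hc : 0 < c) : Continuous fun t : ℝ => c / (c ^ 2 + t ^ 2) :=
    continuous_const.div (by fun_prop) fun t => by positivity
  have hc' : Continuous fun t : ℝ =>
      Real.sin α * Real.cos α / (Real.sin α ^ 2 + Real.sinh t ^ 2) :=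
    continuous_const.div (by fun_prop) fun t => by positivity
  have h := intervalIntegral.hasSum_integral_of_dominated_convergence (μ := volume) (a := 0) (b := x)
    (fun (k : ℕ) _ => ((((k : ℝ) + 1) * π + α) - (((k : ℝ) + 1) * π - α)) /
      ((((k : ℝ) + 1) * π - α) * (((k : ℝ) + 1) * π + α)))
    (fun k => ((hc (ha k)).sub (hc (hb k))).aestronglyMeasurable)
    (fun k => .of_forall fun t _ => abs_div_sub_div_le (ha k) (hab k) t)
    (.of_forall fun _ _ => summable_pole_gap hα0 hαπ) intervalIntegrable_const
    (.of_forall fun t _ => hasSum_re_cot hα0 hαπ t)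
  convert h using 1
  · rfl
  · funext k
    refine Eq.trans ?_ (intervalIntegral.integral_eq_sub_of_hasDerivAt
      (fun t _ => (hasDerivAt_arctan_div (ha k).ne' t).sub (hasDerivAt_arctan_div (hb k).ne' t))
      (((hc (ha k)).sub (hc (hb k))).intervalIntegrable _ _)).symm
    simp
  · refine Eq.trans ?_ (intervalIntegral.integral_eq_sub_of_hasDerivAt
      (fun t _ => (hasDerivAt_arctan_div hα0.ne' t).sub (hasDerivAt_arctan_cot_mul_tanh hsin t))
      (((hc hα0).sub hc').intervalIntegrable _ _)).symm
    simp

theorem stmt_12 (α A : ℝ) (hα0 : 0 < α) (hαπ : α < π) (hA : 0 < A) :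
    HasSum
      (fun k : ℕ =>
        Ti2 (A / (((k : ℝ) + 1) * π - α)) - Ti2 (A / (((k : ℝ) + 1) * π + α)))
      (Ti2 (A / α) - ∫ x in (0:ℝ)..A, Real.arctan (Real.cot α * Real.tanh x) / x) := by
  have hsin : Real.sin α ≠ 0 := (Real.sin_pos_of_pos_of_lt_pi hα0 hαπ).ne'
  have ha := pole_pos hαπ
  have hab (k : ℕ) : ((k : ℝ) + 1) * π - α ≤ ((k : ℝ) + 1) * π + α := by linarith
  have hb (k : ℕ) := (ha k).trans_le (hab k)
  have hi {c : ℝ} (hc : 0 < c) := intervalIntegrable_arctan_div_div hc 0 A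
  simp only [Ti2_div hα0, Ti2_div (ha _), Ti2_div (hb _)]
  rw [← intervalIntegral.integral_sub (hi hα0) (intervalIntegrable_arctan_cot_mul_tanh_div hsin 0 A)]
  simp only [← intervalIntegral.integral_sub (hi (ha _)) (hi (hb _)), ← sub_div]
  refine intervalIntegral.hasSum_integral_of_dominated_convergence
    (fun (k : ℕ) _ => ((((k : ℝ) + 1) * π + α) - (((k : ℝ) + 1) * π - α)) /
      ((((k : ℝ) + 1) * π - α) * (((k : ℝ) + 1) * π + α)))
    (fun k => ?_) (fun k => .of_forall fun t ht => ?_)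
    (.of_forall fun _ _ => summable_pole_gap hα0 hαπ) intervalIntegrable_const
    (.of_forall fun t _ => (hasSum_arctan_sub_arctan hα0 hαπ t).div_const t)
  · exact Measurable.aestronglyMeasurable (by fun_prop)
  · rw [Set.uIoc_of_le hA.le] at ht
    rw [Real.norm_eq_abs, abs_div, div_le_iff₀ (abs_pos.2 ht.1.ne')]
    exact abs_arctan_div_sub_arctan_div_le (ha k) (hab k) t
end
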